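/- arXiv:1110.3034 — 5 statements merged into one kernel-verified Lean document; each statement's English description precedes it below -/
import Mathlib

section
/- Suppose y ∈ K(A,v,n) is a nonzero vector such that (A − θ·I)y is orthogonal to K(A,v,n) for some real number θ (i.e., y is a Ritz vector of A from K(A,v,n) with Ritz value θ). Then ⟨y, v⟩ ≠ 0. -/
open Matrix

/-- The Krylov subspace `K(A,v,n) = span(v, Av, …, A^{n-1}v)`. -/
noncomputable def Krylov {N : ℕ} (A : Matrix (Fin N) (Fin N) ℂ) (v : Fin N → ℂ) (n : ℕ) :
    Submodule ℂ (Fin N → ℂ) :=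
  Submodule.span ℂ {w | ∃ k < n, w = (A ^ k).mulVec v}

theorem Matrix.IsHermitian.star_mulVec_dotProduct {m : Type*} [Fintype m] {A : Matrix m m ℂ}
    (hA : A.IsHermitian) (x w : m → ℂ) : star (A *ᵥ x) ⬝ᵥ w = star x ⬝ᵥ A *ᵥ w := by
  rw [star_mulVec, hA.eq, dotProduct_mulVec]

theorem pow_mulVec_mem_Krylov {N n k : ℕ} (A : Matrix (Fin N) (Fin N) ℂ) (v : Fin N → ℂ)
    (hk : k < n) : (A ^ k) *ᵥ v ∈ Krylov A v n :=
  Submodule.subset_span ⟨k, hk, rfl⟩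

/-- A Ritz vector of a Hermitian matrix `A` from the Krylov space `K(A,v,n)` is not
orthogonal to the initial vector `v`: if `y ∈ K(A,v,n)` is nonzero and `(A − θ)y` is
orthogonal to `K(A,v,n)` for some real `θ`, then `⟨y, v⟩ ≠ 0`. -/
theorem ritz_vector_not_orthogonal_to_initial {N n : ℕ}
    (A : Matrix (Fin N) (Fin N) ℂ) (hA : A.IsHermitian)
    (v : Fin N → ℂ) (hv : v ≠ 0) (hn : 1 ≤ n)
    (θ : ℝ) (y : Fin N → ℂ)
    (hy : y ∈ Krylov A v n) (hy0 : y ≠ 0)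
    (hritz : ∀ w ∈ Krylov A v n, star w ⬝ᵥ (A.mulVec y - (θ : ℂ) • y) = 0) :
    star y ⬝ᵥ v ≠ 0 := by
  intro hyv
  have hpow : ∀ k < n, star y ⬝ᵥ (A ^ k) *ᵥ v = 0 := by
    intro k
    induction k with
    | zero => intro _; simpa using hyv
    | succ k ih =>
      intro hk
      have hk' : k < n := by omega
      have h := congrArg star (hritz _ (pow_mulVec_mem_Krylov A v hk'))
      rw [← star_dotProduct, star_zero, star_sub, sub_dotProduct, hA.star_mulVec_dotProduct,
        star_smul, smul_dotProduct, ih hk', smul_zero, sub_zero, mulVec_mulVec,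
        ← pow_succ'] at h
      exact h
  have horth : ∀ w ∈ Krylov A v n, star y ⬝ᵥ w = 0 := by
    intro w hw
    induction hw using Submodule.span_induction with
    | mem w hw => obtain ⟨k, hk, rfl⟩ := hw; exact hpow k hk
    | zero => exact dotProduct_zero _
    | add a b _ _ ha hb => rw [dotProduct_add, ha, hb, add_zero]
    | smul c a _ ha => rw [dotProduct_smul, ha, smul_zero]
  open scoped ComplexOrder in
  exact hy0 (dotProduct_star_self_eq_zero.mp (horth y hy))
end

section
/- Let (θ, y) and (θ', y') be two Ritz pairs of A from K(A,v,n) with θ ≠ θ' and y, y' orthonormal (so (A−θ·I)y and (A−θ'·I)y' are orthogonal to K(A,v,n)). Then there exists a unit vector u ∈ span(y, y') such that ⟨u, v⟩ = 0 and |⟨u, A v⟩| ≤ |θ − θ'|·‖v‖. -/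
open Matrix

/-- The Cauchy–Schwarz inequality for `star x ⬝ᵥ y` against a unit vector `x`. -/
theorem norm_star_dotProduct_le_of_unit {ι : Type*} [Fintype ι] {x : ι → ℂ}
    (hx : star x ⬝ᵥ x = 1) (y : ι → ℂ) :
    ‖star x ⬝ᵥ y‖ ≤ Real.sqrt (star y ⬝ᵥ y).re := by
  have inner_eq (a b : ι → ℂ) :
      inner ℂ (WithLp.toLp 2 a) (WithLp.toLp 2 b) = star a ⬝ᵥ b := by
    rw [EuclideanSpace.inner_toLp_toLp, dotProduct_comm]
  have norm_eq (a : ι → ℂ) : ‖WithLp.toLp 2 a‖ = Real.sqrt (star a ⬝ᵥ a).re := by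
    rw [norm_eq_sqrt_re_inner (𝕜 := ℂ), inner_eq]
    rfl
  simpa [inner_eq, norm_eq, hx] using
    norm_inner_le_norm (𝕜 := ℂ) (WithLp.toLp 2 x) (WithLp.toLp 2 y)

/-- Every pair of complex numbers is annihilated by some unit vector of `ℂ²`. -/
theorem exists_unit_pair_star_mul_add_eq_zero (a b : ℂ) :
    ∃ α β : ℂ, star α * α + star β * β = 1 ∧ star α * a + star β * b = 0 := by
  by_cases h : a = 0
  · exact ⟨1, 0, by simp, by simp [h]⟩
  have hs : 0 < Complex.normSq a + Complex.normSq b :=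
    add_pos_of_pos_of_nonneg (Complex.normSq_pos.2 h) (Complex.normSq_nonneg b)
  set s := Real.sqrt (Complex.normSq a + Complex.normSq b)
  have hs0 : (s : ℂ) ≠ 0 := by exact_mod_cast (Real.sqrt_pos.2 hs).ne'
  have hsq : (s : ℂ) ^ 2 = star a * a + star b * b := by
    have : s ^ 2 = Complex.normSq a + Complex.normSq b := Real.sq_sqrt hs.le
    rw [← Complex.ofReal_pow, this]
    simp [Complex.normSq_eq_conj_mul_self]
  refine ⟨star b / s, -star a / s, ?_, ?_⟩
  · simp only [star_div₀, star_neg, Complex.star_def, Complex.conj_ofReal,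
      Complex.conj_conj] at hsq ⊢
    field_simp
    linear_combination -hsq
  · simp only [star_div₀, star_neg, Complex.star_def, Complex.conj_ofReal, Complex.conj_conj]
    ring

theorem mem_Krylov_self {N n : ℕ} (A : Matrix (Fin N) (Fin N) ℂ) (v : Fin N → ℂ)
    (hn : 1 ≤ n) : v ∈ Krylov A v n :=
  Submodule.subset_span ⟨0, hn, by simp⟩

/-- If the residual of `(θ, y)` is orthogonal to `v`, then `⟨y, A v⟩ = θ ⟨y, v⟩`. -/
theorem star_dotProduct_mulVec_of_residual_orthogonal {ι : Type*} [Fintype ι]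
    {A : Matrix ι ι ℂ} (hA : A.IsHermitian) {θ : ℝ} {y v : ι → ℂ}
    (h : star v ⬝ᵥ (A.mulVec y - (θ : ℂ) • y) = 0) :
    star y ⬝ᵥ A.mulVec v = θ * (star y ⬝ᵥ v) := by
  have h' := congrArg star h
  rw [← star_dotProduct_star, star_star, star_sub, star_smul, star_mulVec, hA.eq,
    sub_dotProduct, smul_dotProduct, ← dotProduct_mulVec] at h'
  simpa [sub_eq_zero] using h'

/-- Given two Ritz pairs `(θ, y)` and `(θ', y')` of the Hermitian matrix `A` from
`K(A,v,n)` with `θ ≠ θ'` and `y, y'` orthonormal, there is a unit vector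
`u ∈ span(y, y')` with `⟨u, v⟩ = 0` and `|⟨u, A v⟩| ≤ |θ − θ'|·‖v‖`. -/
theorem nearly_degenerate_ritz_pairs {N n : ℕ}
    (A : Matrix (Fin N) (Fin N) ℂ) (hA : A.IsHermitian)
    (v : Fin N → ℂ) (hv : v ≠ 0) (hn : 1 ≤ n)
    (θ θ' : ℝ) (y y' : Fin N → ℂ)
    (hy : y ∈ Krylov A v n) (hy' : y' ∈ Krylov A v n)
    (hyy : star y ⬝ᵥ y = 1) (hy'y' : star y' ⬝ᵥ y' = 1)
    (hyy' : star y ⬝ᵥ y' = 0)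
    (hθθ' : θ ≠ θ')
    (hr : ∀ w ∈ Krylov A v n, star w ⬝ᵥ (A.mulVec y - (θ : ℂ) • y) = 0)
    (hr' : ∀ w ∈ Krylov A v n, star w ⬝ᵥ (A.mulVec y' - (θ' : ℂ) • y') = 0) :
    ∃ u ∈ Submodule.span ℂ ({y, y'} : Set (Fin N → ℂ)),
      star u ⬝ᵥ u = 1 ∧ star u ⬝ᵥ v = 0 ∧
      ‖star u ⬝ᵥ A.mulVec v‖ ≤ |θ - θ'| * Real.sqrt (star v ⬝ᵥ v).re := by
  have hv_mem := mem_Krylov_self A v hn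
  have hAv := star_dotProduct_mulVec_of_residual_orthogonal hA (hr v hv_mem)
  have hAv' := star_dotProduct_mulVec_of_residual_orthogonal hA (hr' v hv_mem)
  have hy'y : star y' ⬝ᵥ y = 0 := by
    rw [← star_star y, star_dotProduct_star, hyy', star_zero]
  obtain ⟨α, β, hunit, horth⟩ :=
    exists_unit_pair_star_mul_add_eq_zero (star y ⬝ᵥ v) (star y' ⬝ᵥ v)
  have expand (w : Fin N → ℂ) : star (α • y + β • y') ⬝ᵥ w =
      star α * (star y ⬝ᵥ w) + star β * (star y' ⬝ᵥ w) := by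
    simp [add_dotProduct]
  refine ⟨α • y + β • y', Submodule.mem_span_pair.2 ⟨α, β, rfl⟩, ?_, ?_, ?_⟩
  · rw [expand]
    simpa [dotProduct_add, hyy, hy'y', hyy', hy'y] using hunit
  · rw [expand, horth]
  · have hα : ‖α‖ ≤ 1 := by
      have hsum : ‖α‖ ^ 2 + ‖β‖ ^ 2 = 1 := by
        have := hunit
        simp only [Complex.star_def, Complex.conj_mul'] at this
        exact_mod_cast this
      nlinarith [sq_nonneg ‖β‖, norm_nonneg α]
    have heq : star (α • y + β • y') ⬝ᵥ A.mulVec v =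
        ((θ - θ' : ℝ) : ℂ) * (star α * (star y ⬝ᵥ v)) := by
      rw [expand, hAv, hAv']
      push_cast
      linear_combination (θ' : ℂ) * horth
    rw [heq, norm_mul, norm_mul, norm_star, Complex.norm_real, Real.norm_eq_abs]
    gcongr
    calc ‖α‖ * ‖star y ⬝ᵥ v‖ ≤ 1 * ‖star y ⬝ᵥ v‖ := by gcongr
      _ = ‖star y ⬝ᵥ v‖ := one_mul _
      _ ≤ _ := norm_star_dotProduct_le_of_unit hyy v
end

section
/- Assume K(A,v,n) has dimension n, and let θ_1 ≥ … ≥ θ_n be the Ritz values of A from K(A,v,n) with orthonormal Ritz vectors y_1, …, y_n. Let 1 ≤ j ≤ n and let p be a polynomial with deg p ≤ n−1 such that p(θ_i) = 0 for every i with 1 ≤ i ≤ j−1. Then p(A)v ∈ span(y_j, y_{j+1}, …, y_n); equivalently, ⟨y_i, p(A)v⟩ = 0 for every i < j. -/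
open Matrix Polynomial

section Compression

variable {N n : ℕ}

theorem aeval_mulVec_eq_sum (A : Matrix (Fin N) (Fin N) ℂ) (p : ℂ[X]) (v : Fin N → ℂ) :
    (aeval A p) *ᵥ v = ∑ k ∈ Finset.range (p.natDegree + 1), p.coeff k • (A ^ k *ᵥ v) := by
  rw [aeval_eq_sum_range, sum_mulVec]
  exact Finset.sum_congr rfl fun k _ => smul_mulVec _ _ _

/-- A left eigenvector of `H` is a left eigenvector of `p(H)`. -/
theorem vecMul_aeval_of_vecMul_eq_smul {H : Matrix (Fin n) (Fin n) ℂ} {w : Fin n → ℂ} {c : ℂ}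
    (h : w ᵥ* H = c • w) (p : ℂ[X]) : w ᵥ* aeval H p = p.eval c • w := by
  have hpow (k : ℕ) : w ᵥ* H ^ k = c ^ k • w := by
    induction k with
    | zero => simp
    | succ k ih => rw [pow_succ, ← vecMul_vecMul, ih, smul_vecMul, h, smul_smul, pow_succ]
  rw [aeval_eq_sum_range, vecMul_sum, eval_eq_sum_range, Finset.sum_smul]
  exact Finset.sum_congr rfl fun k _ => by rw [vecMul_smul, hpow, smul_smul]

/-- `Q Qᴴ` fixes the range of `Q` when the columns of `Q` are orthonormal. -/
theorem mulVec_conjTranspose_mulVec_of_mem_range {Q : Matrix (Fin N) (Fin n) ℂ} (hQ : Qᴴ * Q = 1)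
    {x : Fin N → ℂ} (hx : x ∈ LinearMap.range Q.mulVecLin) : Q *ᵥ (Qᴴ *ᵥ x) = x := by
  obtain ⟨z, rfl⟩ := hx
  rw [mulVecLin_apply, mulVec_mulVec z Qᴴ Q, hQ, one_mulVec]

theorem pow_mulVec_eq_compression {A : Matrix (Fin N) (Fin N) ℂ} {v : Fin N → ℂ}
    {Q : Matrix (Fin N) (Fin n) ℂ} (hQ : Qᴴ * Q = 1)
    (hQX : LinearMap.range Q.mulVecLin = Krylov A v n) {k : ℕ} (hk : k < n) :
    A ^ k *ᵥ v = Q *ᵥ ((Qᴴ * A * Q) ^ k *ᵥ (Qᴴ *ᵥ v)) := by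
  have hproj {k : ℕ} (hk : k < n) : Q *ᵥ (Qᴴ *ᵥ (A ^ k *ᵥ v)) = A ^ k *ᵥ v :=
    mulVec_conjTranspose_mulVec_of_mem_range hQ
      (hQX ▸ Submodule.subset_span ⟨k, hk, rfl⟩)
  induction k with
  | zero => simpa using (hproj hk).symm
  | succ k ih =>
    rw [← hproj hk, pow_succ', ← mulVec_mulVec, ih (by omega), pow_succ']
    simp only [mulVec_mulVec, Matrix.mul_assoc]

theorem aeval_mulVec_eq_compression {A : Matrix (Fin N) (Fin N) ℂ} {v : Fin N → ℂ}
    {Q : Matrix (Fin N) (Fin n) ℂ} (hQ : Qᴴ * Q = 1)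
    (hQX : LinearMap.range Q.mulVecLin = Krylov A v n) {p : ℂ[X]} (hp : p.natDegree < n) :
    aeval A p *ᵥ v = Q *ᵥ (aeval (Qᴴ * A * Q) p *ᵥ (Qᴴ *ᵥ v)) := by
  rw [aeval_mulVec_eq_sum, aeval_mulVec_eq_sum, mulVec_sum]
  refine Finset.sum_congr rfl fun k hk => ?_
  rw [pow_mulVec_eq_compression hQ hQX (by have := Finset.mem_range.1 hk; omega), mulVec_smul]

/-- Expansion of a vector in an orthonormal family of full size. -/
theorem eq_sum_dotProduct_smul {s : Fin n → Fin n → ℂ}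
    (hs : ∀ i k, star (s i) ⬝ᵥ s k = if i = k then 1 else 0) (x : Fin n → ℂ) :
    x = ∑ i, (star (s i) ⬝ᵥ x) • s i := by
  have hS : (Matrix.of s).map star * (Matrix.of s)ᵀ = 1 := by
    ext i k
    rw [one_apply, ← hs i k]
    rfl
  have h := congrArg (· *ᵥ x) (mul_eq_one_comm.1 hS)
  simp only [one_mulVec, ← mulVec_mulVec] at h
  rw [mulVec_eq_sum] at h
  refine h.symm.trans (Finset.sum_congr rfl fun i _ => ?_)
  rw [op_smul_eq_smul]
  rfl

end Compression

/-- Suppose `K(A,v,n)` has dimension `n`, and let `θ 0 ≥ … ≥ θ (n-1)` be the Ritz values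
of the Hermitian matrix `A` from `K(A,v,n)` with orthonormal Ritz vectors
`y i = Q.mulVec (s i)`.  If `p` is a polynomial of degree `≤ n−1` with `p(θ i) = 0` for
all `i < j` (zero-based `j : Fin n`), then `p(A)v ∈ span(y j, …, y (n-1))`; equivalently
`⟨y i, p(A)v⟩ = 0` for every `i < j`. -/
theorem poly_with_ritz_roots_in_tail_span {N n : ℕ}
    (A : Matrix (Fin N) (Fin N) ℂ) (hA : A.IsHermitian)
    (v : Fin N → ℂ) (hv : v ≠ 0) (hn : 1 ≤ n)
    (hK : Module.finrank ℂ (Krylov A v n) = n)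
    (Q : Matrix (Fin N) (Fin n) ℂ) (hQ : Qᴴ * Q = 1)
    (hQX : LinearMap.range Q.mulVecLin = Krylov A v n)
    (θ : Fin n → ℝ) (hθ : Antitone θ)
    (s : Fin n → (Fin n → ℂ))
    (hs : ∀ i k, star (s i) ⬝ᵥ s k = if i = k then 1 else 0)
    (hθs : ∀ i, (Qᴴ * A * Q).mulVec (s i) = (θ i : ℂ) • s i)
    (j : Fin n) (p : Polynomial ℂ) (hdeg : p.natDegree ≤ n - 1)
    (hroots : ∀ i : Fin n, (i : ℕ) < (j : ℕ) → p.eval ((θ i : ℂ)) = 0) :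
    (Polynomial.aeval A p).mulVec v ∈
      Submodule.span ℂ {w | ∃ i : Fin n, (j : ℕ) ≤ (i : ℕ) ∧ w = Q.mulVec (s i)} ∧
    ∀ i : Fin n, (i : ℕ) < (j : ℕ) →
      star (Q.mulVec (s i)) ⬝ᵥ (Polynomial.aeval A p).mulVec v = 0 := by
  set x := aeval (Qᴴ * A * Q) p *ᵥ (Qᴴ *ᵥ v)
  have hx : aeval A p *ᵥ v = Q *ᵥ x := aeval_mulVec_eq_compression hQ hQX (by omega)
  have hH : (Qᴴ * A * Q)ᴴ = Qᴴ * A * Q := (isHermitian_conjTranspose_mul_mul Q hA).eq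
  have hleft (i : Fin n) : star (s i) ᵥ* (Qᴴ * A * Q) = (θ i : ℂ) • star (s i) := by
    have h := congrArg star (hθs i)
    rw [star_mulVec, hH] at h
    simpa using h
  have horth (i : Fin n) (hi : (i : ℕ) < j) : star (s i) ⬝ᵥ x = 0 := by
    rw [dotProduct_mulVec, vecMul_aeval_of_vecMul_eq_smul (hleft i), hroots i hi, zero_smul,
      zero_dotProduct]
  rw [hx]
  refine ⟨?_, fun i hi => ?_⟩
  · rw [eq_sum_dotProduct_smul hs x, mulVec_sum]
    refine Submodule.sum_mem _ fun i _ => ?_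
    rw [mulVec_smul]
    by_cases hi : (i : ℕ) < j
    · rw [horth i hi, zero_smul]
      exact Submodule.zero_mem _
    · exact Submodule.smul_mem _ _ (Submodule.subset_span ⟨i, not_lt.1 hi, rfl⟩)
  · rw [star_mulVec, dotProduct_mulVec, vecMul_vecMul, hQ, vecMul_one, horth i hi]
end

section
/- Let v ∈ ℂ^N, let 1 ≤ j ≤ N, and let p be a polynomial with real coefficients such that p(λ_j)·⟨z_j, v⟩ ≠ 0. Then u = p(A)v is nonzero and ρ(u, λ_j·I − A) ≤ (λ_j − λ_N) · (Σ_{k=j+1}^N |p(λ_k)·⟨z_k, v⟩|²) / |p(λ_j)·⟨z_j, v⟩|². -/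
open Matrix Polynomial

/-- Rayleigh quotient `ρ(u,A) = ⟨u, A u⟩ / ⟨u, u⟩` (real for Hermitian `A`). -/
noncomputable def rayleigh {N : ℕ} (A : Matrix (Fin N) (Fin N) ℂ) (u : Fin N → ℂ) : ℝ :=
  (star u ⬝ᵥ A.mulVec u).re / (star u ⬝ᵥ u).re

/-- Parseval's identity for an orthonormal family of full size in `ℂ^N`. -/
lemma star_dotProduct_eq_sum_of_orthonormal {N : ℕ} (z : Fin N → (Fin N → ℂ))
    (hz : ∀ i k, star (z i) ⬝ᵥ z k = if i = k then 1 else 0) (x y : Fin N → ℂ) :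
    star x ⬝ᵥ y = ∑ k, star (star (z k) ⬝ᵥ x) * (star (z k) ⬝ᵥ y) := by
  set W : Matrix (Fin N) (Fin N) ℂ := Matrix.of fun k i => star (z k i) with hW
  have h1 : W * Wᴴ = 1 := by
    ext i k
    rw [Matrix.one_apply, ← hz i k]
    simp [Matrix.mul_apply, dotProduct, hW]
  have h2 : Wᴴ * W = 1 := mul_eq_one_comm.mp h1
  have hWx : ∀ w : Fin N → ℂ, W *ᵥ w = fun k => star (z k) ⬝ᵥ w := fun w => rfl
  calc star x ⬝ᵥ y = star x ⬝ᵥ ((Wᴴ * W) *ᵥ y) := by rw [h2, Matrix.one_mulVec]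
    _ = star (W *ᵥ x) ⬝ᵥ (W *ᵥ y) := by
      rw [← Matrix.mulVec_mulVec, Matrix.dotProduct_mulVec, Matrix.star_mulVec]
    _ = _ := by rw [hWx, hWx]; rfl

/-- A Hermitian matrix acts on the coefficient along an eigenvector by the eigenvalue. -/
lemma star_dotProduct_mulVec_of_eigenvector {n : Type*} [Fintype n]
    {A : Matrix n n ℂ} (hA : A.IsHermitian) {z : n → ℂ} {l : ℝ}
    (hz : A.mulVec z = (l : ℂ) • z) (x : n → ℂ) :
    star z ⬝ᵥ A.mulVec x = (l : ℂ) * (star z ⬝ᵥ x) := by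
  have h : star z ᵥ* A = (l : ℂ) • star z := by
    conv_lhs => rw [← hA.eq]
    rw [← Matrix.star_mulVec, hz, star_smul]
    simp
  rw [Matrix.dotProduct_mulVec, h, smul_dotProduct, smul_eq_mul]

/-- A polynomial in a Hermitian matrix acts on the coefficient along an eigenvector by the
value of the polynomial at the eigenvalue. -/
lemma star_dotProduct_aeval_mulVec_of_eigenvector {n : Type*} [Fintype n] [DecidableEq n]
    {A : Matrix n n ℂ} (hA : A.IsHermitian) {z : n → ℂ} {l : ℝ}
    (hz : A.mulVec z = (l : ℂ) • z) (q : Polynomial ℂ) (x : n → ℂ) :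
    star z ⬝ᵥ (Polynomial.aeval A q).mulVec x = q.eval (l : ℂ) * (star z ⬝ᵥ x) := by
  induction q using Polynomial.induction_on' generalizing x with
  | add p q hp hq => simp [Matrix.add_mulVec, dotProduct_add, hp, hq, add_mul]
  | monomial m a =>
    have hpow : star z ⬝ᵥ (A ^ m).mulVec x = (l : ℂ) ^ m * (star z ⬝ᵥ x) := by
      induction m with
      | zero => simp
      | succ m ih =>
        rw [pow_succ', ← Matrix.mulVec_mulVec, star_dotProduct_mulVec_of_eigenvector hA hz, ih]
        ring
    rw [Polynomial.aeval_monomial, ← Algebra.smul_def, Matrix.smul_mulVec, dotProduct_smul, hpow,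
      Polynomial.eval_monomial, smul_eq_mul, mul_assoc]

/-- For a real polynomial `p` with `p(λ_j)·⟨z_j, v⟩ ≠ 0`, the vector `u = p(A)v` is
nonzero and `ρ(u, λ_j·I − A) ≤ (λ_j − λ_N)·(Σ_{k>j} |p(λ_k)⟨z_k,v⟩|²)/|p(λ_j)⟨z_j,v⟩|²`.
Here `lam` (decreasing) and `z` are the eigenvalues and orthonormal eigenvectors of the
Hermitian matrix `A`; indices are zero-based, so `λ_N = lam ⟨N-1,_⟩`. -/
theorem rayleigh_bound_of_polynomial {N : ℕ} (hN : 0 < N)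
    (A : Matrix (Fin N) (Fin N) ℂ) (hA : A.IsHermitian)
    (lam : Fin N → ℝ) (hlam : Antitone lam)
    (z : Fin N → (Fin N → ℂ))
    (hz : ∀ i k, star (z i) ⬝ᵥ z k = if i = k then 1 else 0)
    (hAz : ∀ i, A.mulVec (z i) = (lam i : ℂ) • z i)
    (v : Fin N → ℂ) (j : Fin N) (p : Polynomial ℝ)
    (hp : (Complex.ofReal (p.eval (lam j))) * (star (z j) ⬝ᵥ v) ≠ 0) :
    (Polynomial.aeval A (p.map (algebraMap ℝ ℂ))).mulVec v ≠ 0 ∧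
    rayleigh (((lam j : ℂ)) • (1 : Matrix (Fin N) (Fin N) ℂ) - A)
        ((Polynomial.aeval A (p.map (algebraMap ℝ ℂ))).mulVec v) ≤
      (lam j - lam ⟨N - 1, Nat.sub_one_lt hN.ne'⟩) *
        (∑ k ∈ Finset.univ.filter fun k : Fin N => (j : ℕ) < (k : ℕ),
          ‖(Complex.ofReal (p.eval (lam k))) * (star (z k) ⬝ᵥ v)‖ ^ 2) /
        ‖(Complex.ofReal (p.eval (lam j))) * (star (z j) ⬝ᵥ v)‖ ^ 2 := by
  set u := (Polynomial.aeval A (p.map (algebraMap ℝ ℂ))).mulVec v with hu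
  have hc : ∀ k, (Complex.ofReal (p.eval (lam k))) * (star (z k) ⬝ᵥ v) = star (z k) ⬝ᵥ u := by
    intro k
    rw [hu, star_dotProduct_aeval_mulVec_of_eigenvector hA (hAz k)]
    congr 1
    exact (Polynomial.eval_map_apply (algebraMap ℝ ℂ) (lam k)).symm
  simp only [hc] at hp ⊢
  have hden : (star u ⬝ᵥ u).re = ∑ k, ‖star (z k) ⬝ᵥ u‖ ^ 2 := by
    rw [star_dotProduct_eq_sum_of_orthonormal z hz, Complex.re_sum]
    refine Finset.sum_congr rfl fun k _ => ?_
    rw [Complex.star_def, Complex.conj_mul']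
    norm_cast
  have hnum : (star u ⬝ᵥ ((lam j : ℂ) • (1 : Matrix (Fin N) (Fin N) ℂ) - A).mulVec u).re =
      ∑ k, (lam j - lam k) * ‖star (z k) ⬝ᵥ u‖ ^ 2 := by
    rw [star_dotProduct_eq_sum_of_orthonormal z hz, Complex.re_sum]
    refine Finset.sum_congr rfl fun k _ => ?_
    rw [Matrix.sub_mulVec, Matrix.smul_mulVec, Matrix.one_mulVec, dotProduct_sub,
      dotProduct_smul, star_dotProduct_mulVec_of_eigenvector hA (hAz k), smul_eq_mul, ← sub_mul,
      mul_left_comm, Complex.star_def, Complex.conj_mul']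
    norm_cast
  have hlast : ∀ k, lam ⟨N - 1, Nat.sub_one_lt hN.ne'⟩ ≤ lam k := fun k =>
    hlam (Fin.mk_le_mk.mpr (Nat.le_sub_one_of_lt k.isLt))
  refine ⟨fun h0 => hp (by rw [h0, dotProduct_zero]), ?_⟩
  rw [rayleigh, hnum, hden]
  refine div_le_div₀ ?_ ?_ (by positivity) ?_
  · exact mul_nonneg (sub_nonneg.mpr (hlast j)) (Finset.sum_nonneg fun k _ => by positivity)
  · rw [Finset.mul_sum, Finset.sum_filter]
    refine Finset.sum_le_sum fun k _ => ?_
    split_ifs with hk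
    · exact mul_le_mul_of_nonneg_right (sub_le_sub_left (hlast k) _) (by positivity)
    · exact mul_nonpos_of_nonpos_of_nonneg
        (sub_nonpos.mpr (hlam (Fin.le_def.mpr (not_lt.mp hk)))) (by positivity)
  · exact Finset.single_le_sum (f := fun k => ‖star (z k) ⬝ᵥ u‖ ^ 2)
      (fun k _ => by positivity) (Finset.mem_univ j)
end

section
/- (Kaniel–Paige–Saad bound.) Assume K(A,v,n) has dimension n, and let θ_1 ≥ … ≥ θ_n be the Ritz values of A from K(A,v,n). Let 1 ≤ j ≤ n and assume: ⟨z_j, v⟩ ≠ 0; λ_{j+1} > λ_N; and θ_i > λ_j for every i with 1 ≤ i ≤ j−1. Then 0 ≤ λ_j − θ_j ≤ (λ_j − λ_N)·(K_j·tan∠_j)² / T_{n−j}(γ_j(λ_j))². -/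
open Matrix Polynomial

/-- Parseval's identity for an orthonormal basis of `ℂ^m`. -/
lemma dotProduct_eq_sum_of_orthonormal {m : Type*} [Fintype m] [DecidableEq m]
    {z : m → m → ℂ} (hz : ∀ i k, star (z i) ⬝ᵥ z k = if i = k then 1 else 0) (x y : m → ℂ) :
    star x ⬝ᵥ y = ∑ k, star (star (z k) ⬝ᵥ x) * (star (z k) ⬝ᵥ y) := by
  let Z : Matrix m m ℂ := Matrix.of fun k => star (z k)
  have hZ : Z * Zᴴ = 1 := by
    ext i k
    simpa [Z, Matrix.mul_apply, Matrix.one_apply, dotProduct] using hz i k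
  have hZ' : Zᴴ * Z = 1 := mul_eq_one_comm.mp hZ
  calc star x ⬝ᵥ y = star (Z *ᵥ x) ⬝ᵥ (Z *ᵥ y) := by
        rw [star_mulVec, dotProduct_mulVec, vecMul_vecMul, hZ', vecMul_one]
    _ = _ := rfl

lemma star_dotProduct_self_re {m : Type*} [Fintype m] [DecidableEq m]
    {z : m → m → ℂ} (hz : ∀ i k, star (z i) ⬝ᵥ z k = if i = k then 1 else 0) (x : m → ℂ) :
    (star x ⬝ᵥ x).re = ∑ k, ‖star (z k) ⬝ᵥ x‖ ^ 2 := by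
  rw [dotProduct_eq_sum_of_orthonormal hz, Complex.re_sum]
  refine Finset.sum_congr rfl fun k _ => ?_
  rw [← Complex.normSq_eq_norm_sq, Complex.star_def, ← Complex.normSq_eq_conj_mul_self,
    Complex.ofReal_re]

/-- An eigenvector of a Hermitian matrix with a real eigenvalue is also a left eigenvector. -/
lemma star_eigenvector_dotProduct_mulVec {m : Type*} [Fintype m] {A : Matrix m m ℂ}
    (hA : A.IsHermitian) {w : m → ℂ} {l : ℝ} (hw : A *ᵥ w = (l : ℂ) • w) (x : m → ℂ) :
    star w ⬝ᵥ (A *ᵥ x) = l * (star w ⬝ᵥ x) := by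
  have h : star w ᵥ* A = (l : ℂ) • star w := by
    have := star_mulVec A w
    rw [hA.eq, hw] at this
    rw [← this]
    simp
  rw [dotProduct_mulVec, h, smul_dotProduct, smul_eq_mul]

lemma star_dotProduct_mulVec_self_re {m : Type*} [Fintype m] [DecidableEq m]
    {A : Matrix m m ℂ} (hA : A.IsHermitian) {z : m → m → ℂ} {l : m → ℝ}
    (hz : ∀ i k, star (z i) ⬝ᵥ z k = if i = k then 1 else 0)
    (hAz : ∀ i, A *ᵥ z i = (l i : ℂ) • z i) (x : m → ℂ) :
    (star x ⬝ᵥ (A *ᵥ x)).re = ∑ k, l k * ‖star (z k) ⬝ᵥ x‖ ^ 2 := by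
  rw [dotProduct_eq_sum_of_orthonormal hz, Complex.re_sum]
  refine Finset.sum_congr rfl fun k _ => ?_
  rw [star_eigenvector_dotProduct_mulVec hA (hAz k), mul_left_comm, Complex.star_def,
    ← Complex.normSq_eq_conj_mul_self, ← Complex.normSq_eq_norm_sq, ← Complex.ofReal_mul,
    Complex.ofReal_re]

lemma star_eigenvector_dotProduct_aeval {m : Type*} [Fintype m] [DecidableEq m]
    {A : Matrix m m ℂ} (hA : A.IsHermitian) {w : m → ℂ} {l : ℝ}
    (hw : A *ᵥ w = (l : ℂ) • w) (p : ℝ[X]) (x : m → ℂ) :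
    star w ⬝ᵥ (aeval A p *ᵥ x) = (p.eval l : ℝ) * (star w ⬝ᵥ x) := by
  induction p using Polynomial.induction_on' with
  | add p q hp hq =>
    rw [map_add, add_mulVec, dotProduct_add, hp, hq, eval_add, Complex.ofReal_add, add_mul]
  | monomial k a =>
    have hpow : star w ⬝ᵥ ((A ^ k) *ᵥ x) = (l : ℂ) ^ k * (star w ⬝ᵥ x) := by
      induction k with
      | zero => simp
      | succ k ih =>
        rw [pow_succ', ← mulVec_mulVec, star_eigenvector_dotProduct_mulVec hA hw, ih]
        ring
    rw [aeval_monomial, Algebra.algebraMap_eq_smul_one, smul_mul_assoc, one_mul, smul_mulVec,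
      dotProduct_smul, hpow, eval_monomial, Complex.real_smul]
    push_cast
    ring

lemma aeval_mulVec_mem_krylov {N n : ℕ} (A : Matrix (Fin N) (Fin N) ℂ) (v : Fin N → ℂ)
    {p : ℝ[X]} (hp : p.natDegree < n) : aeval A p *ᵥ v ∈ Krylov A v n := by
  rw [aeval_eq_sum_range' hp, sum_mulVec]
  refine Submodule.sum_mem _ fun k hk => ?_
  rw [smul_mulVec]
  exact Submodule.smul_of_tower_mem _ _
    (Submodule.subset_span ⟨k, Finset.mem_range.mp hk, rfl⟩)

lemma star_mulVec_dotProduct_mulVec {m k : Type*} [Fintype m] [Fintype k]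
    (Q : Matrix m k ℂ) (c d : k → ℂ) (y : m → ℂ) (h : Qᴴ *ᵥ y = d) :
    star (Q *ᵥ c) ⬝ᵥ y = star c ⬝ᵥ d := by
  rw [star_mulVec, ← dotProduct_mulVec, h]

open scoped ComplexOrder in
/-- The Ritz values are dominated by the corresponding eigenvalues. -/
lemma ritz_le_eigenvalue {N n : ℕ}
    {A : Matrix (Fin N) (Fin N) ℂ} (hA : A.IsHermitian)
    {lam : Fin N → ℝ} (hlam : Antitone lam) {z : Fin N → (Fin N → ℂ)}
    (hz : ∀ i k, star (z i) ⬝ᵥ z k = if i = k then 1 else 0)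
    (hAz : ∀ i, A *ᵥ z i = (lam i : ℂ) • z i) (hnN : n ≤ N)
    {Q : Matrix (Fin N) (Fin n) ℂ} (hQ : Qᴴ * Q = 1)
    {θ : Fin n → ℝ} (hθ : Antitone θ) {s : Fin n → (Fin n → ℂ)}
    (hs : ∀ i k, star (s i) ⬝ᵥ s k = if i = k then 1 else 0)
    (hθs : ∀ i, (Qᴴ * A * Q) *ᵥ s i = (θ i : ℂ) • s i) (j : Fin n) :
    θ j ≤ lam (Fin.castLE hnN j) := by
  let M : Fin n → Fin n → ℂ := fun i =>
    if i < j then star (z (Fin.castLE hnN i)) ᵥ* Q else if i = j then 0 else star (s i)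
  have hdet : (Matrix.of M).det = 0 := det_eq_zero_of_row_eq_zero j fun k => by simp [M]
  obtain ⟨c, hc0, hc⟩ := exists_mulVec_eq_zero_iff.mpr hdet
  have hrow : ∀ i, M i ⬝ᵥ c = 0 := fun i => congrFun hc i
  have hcz : ∀ k : Fin N, (k : ℕ) < j → star (z k) ⬝ᵥ (Q *ᵥ c) = 0 := by
    intro k hk
    have h := hrow ⟨k, hk.trans j.2⟩
    have hlt : (⟨k, hk.trans j.2⟩ : Fin n) < j := hk
    simpa [M, hlt, ← dotProduct_mulVec] using h
  have hcs : ∀ i, j < i → star (s i) ⬝ᵥ c = 0 := by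
    intro i hi
    have h := hrow i
    simpa [M, hi.not_gt, hi.ne'] using h
  have hH : (Qᴴ * A * Q).IsHermitian := isHermitian_conjTranspose_mul_mul Q hA
  have e1 := star_dotProduct_self_re hs c
  have e2 := star_dotProduct_mulVec_self_re hH hs hθs c
  have e3 := star_dotProduct_self_re hz (Q *ᵥ c)
  have e4 := star_dotProduct_mulVec_self_re hA hz hAz (Q *ᵥ c)
  rw [star_mulVec_dotProduct_mulVec Q c c _ (by rw [mulVec_mulVec, hQ, one_mulVec])] at e3
  rw [star_mulVec_dotProduct_mulVec Q c _ _ (by rw [mulVec_mulVec, mulVec_mulVec])] at e4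
  have h1 : θ j * (star c ⬝ᵥ c).re ≤ (star c ⬝ᵥ ((Qᴴ * A * Q) *ᵥ c)).re := by
    rw [e1, e2, Finset.mul_sum]
    refine Finset.sum_le_sum fun i _ => ?_
    rcases le_or_gt i j with hi | hi
    · exact mul_le_mul_of_nonneg_right (hθ hi) (sq_nonneg _)
    · simp [hcs i hi]
  have h2 : (star c ⬝ᵥ ((Qᴴ * A * Q) *ᵥ c)).re
      ≤ lam (Fin.castLE hnN j) * (star c ⬝ᵥ c).re := by
    rw [e3, e4, Finset.mul_sum]
    refine Finset.sum_le_sum fun k _ => ?_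
    rcases lt_or_ge (k : ℕ) j with hk | hk
    · simp [hcz k hk]
    · exact mul_le_mul_of_nonneg_right (hlam hk) (sq_nonneg _)
  have hpos : 0 < (star c ⬝ᵥ c).re :=
    (Complex.pos_iff.mp (dotProduct_star_self_pos_iff.mpr hc0)).1
  exact le_of_mul_le_mul_right (h1.trans h2) hpos

/-- A polynomial of degree less than `n` that vanishes at the Ritz values `θ i` with `i < j`
produces a Krylov vector whose Rayleigh quotient is at most `θ j`. -/
lemma sum_eigenvalue_mul_le_ritz_mul {N n : ℕ}
    {A : Matrix (Fin N) (Fin N) ℂ} (hA : A.IsHermitian)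
    {lam : Fin N → ℝ} {z : Fin N → (Fin N → ℂ)}
    (hz : ∀ i k, star (z i) ⬝ᵥ z k = if i = k then 1 else 0)
    (hAz : ∀ i, A *ᵥ z i = (lam i : ℂ) • z i) (v : Fin N → ℂ)
    {Q : Matrix (Fin N) (Fin n) ℂ} (hQ : Qᴴ * Q = 1)
    (hQX : LinearMap.range Q.mulVecLin = Krylov A v n)
    {θ : Fin n → ℝ} (hθ : Antitone θ) {s : Fin n → (Fin n → ℂ)}
    (hs : ∀ i k, star (s i) ⬝ᵥ s k = if i = k then 1 else 0)
    (hθs : ∀ i, (Qᴴ * A * Q) *ᵥ s i = (θ i : ℂ) • s i) (j : Fin n)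
    {p : ℝ[X]} (hp : p.natDegree < n) (hroot : ∀ i < j, p.IsRoot (θ i)) :
    ∑ k, lam k * (p.eval (lam k) ^ 2 * ‖star (z k) ⬝ᵥ v‖ ^ 2) ≤
      θ j * ∑ k, p.eval (lam k) ^ 2 * ‖star (z k) ⬝ᵥ v‖ ^ 2 := by
  have hH : (Qᴴ * A * Q).IsHermitian := isHermitian_conjTranspose_mul_mul Q hA
  have hlift : ∀ q : ℝ[X], q.natDegree < n → ∃ c, Q *ᵥ c = aeval A q *ᵥ v := by
    intro q hq
    have := aeval_mulVec_mem_krylov A v hq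
    rw [← hQX] at this
    exact this
  obtain ⟨c, hc⟩ := hlift p hp
  have hcs : ∀ i < j, star (s i) ⬝ᵥ c = 0 := by
    intro i hi
    obtain ⟨r, hr⟩ := dvd_iff_isRoot.mpr (hroot i hi)
    have hrdeg : r.natDegree < n :=
      lt_of_le_of_lt (by
        rcases eq_or_ne r 0 with rfl | h0
        · simp
        · rw [hr, natDegree_mul (X_sub_C_ne_zero _) h0]
          omega) hp
    obtain ⟨d, hd⟩ := hlift r hrdeg
    have hcd : c = (Qᴴ * A * Q) *ᵥ d - (θ i : ℂ) • d := by
      have hQc : Q *ᵥ c = A *ᵥ (Q *ᵥ d) - (θ i : ℂ) • (Q *ᵥ d) := by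
        rw [hc, hr, hd, map_mul, map_sub, aeval_X, aeval_C, ← mulVec_mulVec, sub_mulVec,
          Algebra.algebraMap_eq_smul_one, smul_mulVec, one_mulVec]
        rfl
      have := congrArg (Qᴴ *ᵥ ·) hQc
      simpa [mulVec_sub, mulVec_smul, mulVec_mulVec, hQ, Matrix.mul_assoc] using this
    rw [hcd, dotProduct_sub, star_eigenvector_dotProduct_mulVec hH (hθs i), dotProduct_smul,
      smul_eq_mul, sub_self]
  have e1 := star_dotProduct_self_re hs c
  have e2 := star_dotProduct_mulVec_self_re hH hs hθs c
  have e3 := star_dotProduct_self_re hz (Q *ᵥ c)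
  have e4 := star_dotProduct_mulVec_self_re hA hz hAz (Q *ᵥ c)
  rw [star_mulVec_dotProduct_mulVec Q c c _ (by rw [mulVec_mulVec, hQ, one_mulVec])] at e3
  rw [star_mulVec_dotProduct_mulVec Q c _ _ (by rw [mulVec_mulVec, mulVec_mulVec])] at e4
  have hnorm : ∀ k, ‖star (z k) ⬝ᵥ (Q *ᵥ c)‖ ^ 2
      = p.eval (lam k) ^ 2 * ‖star (z k) ⬝ᵥ v‖ ^ 2 := by
    intro k
    rw [hc, star_eigenvector_dotProduct_aeval hA (hAz k), norm_mul, mul_pow,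
      Complex.norm_real, Real.norm_eq_abs, sq_abs]
  simp only [hnorm] at e3 e4
  rw [← e3, ← e4, e1, e2, Finset.mul_sum]
  refine Finset.sum_le_sum fun i _ => ?_
  rcases lt_or_ge i j with hi | hi
  · simp [hcs i hi]
  · exact mul_le_mul_of_nonneg_right (hθ hi) (sq_nonneg _)

/-- A weighted mean `t` of decreasing reals `l k` is close to `l a` if the weights `P k ^ 2 * w k`
concentrate at indices up to `a`. -/
lemma sub_le_of_sum_mul_le {m : Type*} [Fintype m] [LinearOrder m] {l P w : m → ℝ}
    {t b B D : ℝ} {a : m} (hl : Antitone l) (hb : ∀ k, b ≤ l k) (hw : ∀ k, 0 ≤ w k)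
    (hwa : 0 < w a) (hD : 0 < D) (hPa : P a ^ 2 = D) (hP : ∀ k, a < k → P k ^ 2 ≤ B)
    (ht : t ≤ l a)
    (hsum : ∑ k, l k * (P k ^ 2 * w k) ≤ t * ∑ k, P k ^ 2 * w k) :
    l a - t ≤ (l a - b) * (B / D * ((∑ k ∈ Finset.univ.filter (a < ·), w k) / w a)) := by
  have h0 : ∀ k, 0 ≤ P k ^ 2 * w k := fun k => mul_nonneg (sq_nonneg _) (hw k)
  have h1 : (l a - t) * (D * w a) ≤ (l a - t) * ∑ k, P k ^ 2 * w k := by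
    refine mul_le_mul_of_nonneg_left ?_ (sub_nonneg.mpr ht)
    rw [← hPa]
    exact Finset.single_le_sum (f := fun k => P k ^ 2 * w k) (fun k _ => h0 k)
      (Finset.mem_univ a)
  have h2 : (l a - t) * ∑ k, P k ^ 2 * w k ≤ ∑ k, (l a - l k) * (P k ^ 2 * w k) := by
    simp only [sub_mul, Finset.sum_sub_distrib, ← Finset.mul_sum]
    linarith
  have h3 : ∑ k, (l a - l k) * (P k ^ 2 * w k)
      ≤ ∑ k ∈ Finset.univ.filter (a < ·), (l a - b) * (B * w k) := by
    rw [Finset.sum_filter]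
    refine Finset.sum_le_sum fun k _ => ?_
    split_ifs with hk
    · exact mul_le_mul (by linarith [hb k]) (mul_le_mul_of_nonneg_right (hP k hk) (hw k)) (h0 k)
        (sub_nonneg.mpr (hb a))
    · exact mul_nonpos_of_nonpos_of_nonneg (sub_nonpos.mpr (hl (not_lt.mp hk))) (h0 k)
  rw [← Finset.mul_sum, ← Finset.mul_sum] at h3
  have h4 := (h1.trans h2).trans h3
  rw [← le_div_iff₀ (mul_pos hD hwa)] at h4
  refine h4.trans_eq ?_
  field_simp

/-- **Kaniel–Paige–Saad bound.**  Let `A` be Hermitian with eigenvalues `lam` in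
decreasing order and orthonormal eigenvectors `z`.  Assume `K(A,v,n)` has dimension `n`
and let `θ 0 ≥ … ≥ θ (n-1)` be the Ritz values of `A` from `K(A,v,n)` (eigenvalues of
`Qᴴ A Q` with orthonormal eigenvectors `s`, the columns of `Q` being an orthonormal basis
of the Krylov space).  For zero-based `j : Fin n` (1-based `j+1`), assuming
`⟨z_j, v⟩ ≠ 0`, `λ_{j+1} > λ_N` and `θ_i > λ_j` for all `i < j`,
`0 ≤ λ_j − θ_j ≤ (λ_j − λ_N)·(K_j·tan∠_j)² / T_{n−j}(γ_j(λ_j))²`, where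
`(tan∠_j)² = (Σ_{k>j} |⟨z_k,v⟩|²)/|⟨z_j,v⟩|²`,
`K_j = ∏_{i<j} (θ_i − λ_N)/(θ_i − λ_j)`, and
`γ_j(λ) = 1 + 2(λ − λ_{j+1})/(λ_{j+1} − λ_N)`. -/
theorem kaniel_paige_saad {N n : ℕ}
    (A : Matrix (Fin N) (Fin N) ℂ) (hA : A.IsHermitian)
    (lam : Fin N → ℝ) (hlam : Antitone lam)
    (z : Fin N → (Fin N → ℂ))
    (hz : ∀ i k, star (z i) ⬝ᵥ z k = if i = k then 1 else 0)
    (hAz : ∀ i, A.mulVec (z i) = (lam i : ℂ) • z i)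
    (v : Fin N → ℂ) (hv : v ≠ 0) (hn : 1 ≤ n)
    (hK : Module.finrank ℂ (Krylov A v n) = n) (hnN : n ≤ N)
    (Q : Matrix (Fin N) (Fin n) ℂ) (hQ : Qᴴ * Q = 1)
    (hQX : LinearMap.range Q.mulVecLin = Krylov A v n)
    (θ : Fin n → ℝ) (hθ : Antitone θ)
    (s : Fin n → (Fin n → ℂ))
    (hs : ∀ i k, star (s i) ⬝ᵥ s k = if i = k then 1 else 0)
    (hθs : ∀ i, (Qᴴ * A * Q).mulVec (s i) = (θ i : ℂ) • s i)
    (j : Fin n) (hjN : (j : ℕ) + 1 < N)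
    (hzv : star (z (Fin.castLE hnN j)) ⬝ᵥ v ≠ 0)
    (hgap : lam ⟨(j : ℕ) + 1, hjN⟩ > lam ⟨N - 1, by omega⟩)
    (hθi : ∀ i : Fin n, (i : ℕ) < (j : ℕ) → θ i > lam (Fin.castLE hnN j)) :
    0 ≤ lam (Fin.castLE hnN j) - θ j ∧
    lam (Fin.castLE hnN j) - θ j ≤
      (lam (Fin.castLE hnN j) - lam ⟨N - 1, by omega⟩) *
        ((∏ i ∈ Finset.univ.filter fun i : Fin n => (i : ℕ) < (j : ℕ),
            (θ i - lam ⟨N - 1, by omega⟩) / (θ i - lam (Fin.castLE hnN j))) ^ 2 *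
          ((∑ k ∈ Finset.univ.filter fun k : Fin N => (j : ℕ) < (k : ℕ),
              ‖star (z k) ⬝ᵥ v‖ ^ 2) / ‖star (z (Fin.castLE hnN j)) ⬝ᵥ v‖ ^ 2)) /
        ((Polynomial.Chebyshev.T ℝ ((n : ℤ) - (j : ℕ) - 1)).eval
          (1 + 2 * (lam (Fin.castLE hnN j) - lam ⟨(j : ℕ) + 1, hjN⟩) /
            (lam ⟨(j : ℕ) + 1, hjN⟩ - lam ⟨N - 1, by omega⟩))) ^ 2 := by
  have hle : θ j ≤ lam (Fin.castLE hnN j) :=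
    ritz_le_eigenvalue hA hlam hz hAz hnN hQ hθ hs hθs j
  refine ⟨sub_nonneg.mpr hle, ?_⟩
  set b := lam ⟨N - 1, by omega⟩
  set μ := lam ⟨(j : ℕ) + 1, hjN⟩
  set a := Fin.castLE hnN j with hadef
  have hb : ∀ k, b ≤ lam k := fun k => hlam (Fin.le_def.mpr (by simp only; omega))
  have hμa : μ ≤ lam a := hlam (Fin.le_def.mpr (by simp [a]))
  have hμb : 0 < μ - b := sub_pos.mpr hgap
  set I := Finset.univ.filter fun i : Fin n => (i : ℕ) < (j : ℕ)
  have hIcard : I.card = j := by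
    have : I = Finset.Iio j := by ext i; simp [I]
    rw [this, Fin.card_Iio]
  set τ := Polynomial.Chebyshev.T ℝ ((n : ℤ) - (j : ℕ) - 1) with hτ
  set g : ℝ → ℝ := fun x => 1 + 2 * (x - μ) / (μ - b) with hg
  let f : ℝ[X] := C (2 / (μ - b)) * X + C (1 - 2 * μ / (μ - b))
  have hf : ∀ x, f.eval x = g x := by
    intro x
    simp only [f, hg, eval_add, eval_mul, eval_C, eval_X]
    ring
  let p : ℝ[X] := (∏ i ∈ I, (X - C (θ i))) * τ.comp f
  have heval : ∀ x, p.eval x = (∏ i ∈ I, (x - θ i)) * τ.eval (g x) := by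
    intro x
    simp [p, eval_prod, hf]
  have hpdeg : p.natDegree < n := by
    have h1 : (∏ i ∈ I, (X - C (θ i))).natDegree = (j : ℕ) := by
      rw [natDegree_prod_of_monic _ _ fun i _ => monic_X_sub_C _]
      simp [hIcard]
    have h2 : (τ.comp f).natDegree ≤ n - j - 1 := by
      rw [natDegree_comp]
      have hτdeg : τ.natDegree = n - j - 1 := by
        rw [hτ, Polynomial.Chebyshev.natDegree_T]
        omega
      have hfdeg : f.natDegree ≤ 1 := natDegree_linear_le
      calc τ.natDegree * f.natDegree ≤ τ.natDegree * 1 := Nat.mul_le_mul_left _ hfdeg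
        _ = n - j - 1 := by rw [mul_one, hτdeg]
    have h3 : p.natDegree ≤ _ := natDegree_mul_le
    have := j.2
    omega
  have hroot : ∀ i < j, p.IsRoot (θ i) := by
    intro i hi
    rw [IsRoot.def, heval, Finset.prod_eq_zero (i := i) (by simpa [I] using hi) (sub_self _),
      zero_mul]
  have hsum := sum_eigenvalue_mul_le_ritz_mul hA hz hAz v hQ hQX hθ hs hθs j hpdeg hroot
  have hθI : ∀ i ∈ I, lam a < θ i := fun i hi => hθi i (Finset.mem_filter.mp hi).2
  have hT : 1 ≤ τ.eval (g (lam a)) := by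
    refine Polynomial.Chebyshev.one_le_eval_T_real _ ?_
    have : 0 ≤ 2 * (lam a - μ) / (μ - b) := div_nonneg (by linarith) hμb.le
    simp only [hg]
    linarith
  have hgaps : 0 < ∏ i ∈ I, (θ i - lam a) :=
    Finset.prod_pos fun i hi => sub_pos.mpr (hθI i hi)
  have hPa : p.eval (lam a) ^ 2 = (∏ i ∈ I, (θ i - lam a)) ^ 2 * τ.eval (g (lam a)) ^ 2 := by
    rw [heval, mul_pow, ← Finset.prod_pow, ← Finset.prod_pow]
    congr 1
    exact Finset.prod_congr rfl fun i _ => by ring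
  have hP : ∀ k, a < k → p.eval (lam k) ^ 2 ≤ (∏ i ∈ I, (θ i - b)) ^ 2 := by
    intro k hk
    have hkμ : lam k ≤ μ := hlam (Fin.le_def.mpr (Nat.succ_le_of_lt (Fin.lt_def.mp hk)))
    have hτ1 : τ.eval (g (lam k)) ^ 2 ≤ 1 := by
      rw [sq_le_one_iff_abs_le_one]
      refine Polynomial.Chebyshev.abs_eval_T_real_le_one _ ?_
      have hlow : -2 ≤ 2 * (lam k - μ) / (μ - b) := by
        rw [le_div_iff₀ hμb]
        linarith [hb k]
      have hupp : 2 * (lam k - μ) / (μ - b) ≤ 0 :=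
        div_nonpos_of_nonpos_of_nonneg (by linarith) hμb.le
      simp only [hg]
      rw [abs_le]
      constructor <;> linarith
    have hprod : (∏ i ∈ I, (lam k - θ i)) ^ 2 ≤ (∏ i ∈ I, (θ i - b)) ^ 2 := by
      rw [← Finset.prod_pow, ← Finset.prod_pow]
      refine Finset.prod_le_prod (fun i _ => sq_nonneg _) fun i hi => ?_
      have := hθI i hi
      have := hb k
      rw [← neg_sub, neg_sq]
      exact pow_le_pow_left₀ (by linarith) (by linarith) 2
    rw [heval, mul_pow]
    calc _ ≤ (∏ i ∈ I, (θ i - b)) ^ 2 * 1 :=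
          mul_le_mul hprod hτ1 (sq_nonneg _) (sq_nonneg _)
      _ = _ := mul_one _
  have key := sub_le_of_sum_mul_le (P := fun k => p.eval (lam k)) hlam hb
    (fun k => sq_nonneg ‖star (z k) ⬝ᵥ v‖) (pow_pos (norm_pos_iff.mpr hzv) 2)
    (mul_pos (pow_pos hgaps 2) (pow_pos (one_pos.trans_le hT) 2)) hPa hP hle hsum
  refine key.trans_eq ?_
  rw [Finset.prod_div_distrib, div_pow, div_mul_eq_div_div]
  simp only [Fin.lt_def, hadef, Fin.val_castLE, hg]
  ring
end
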